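/- Let Q ∈ (0,1) and let e₀, e₁, e₂, e₃ ∈ ℂ^d satisfy ‖e₀‖² = ‖e₃‖² = 1 − Q and ‖e₁‖² = ‖e₂‖² = Q. Define the (2d)×(2d) block-diagonal matrix χ_AE with block 0 equal to (1/2)(|e₀⟩⟨e₀| + |e₁⟩⟨e₁|) and block 1 equal to (1/2)(|e₂⟩⟨e₂| + |e₃⟩⟨e₃|), and define the d×d matrix χ_E = (1/2)(|e₀⟩⟨e₀| + |e₁⟩⟨e₁| + |e₂⟩⟨e₂| + |e₃⟩⟨e₃|). Then S(χ_AE) − S(χ_E) ≥ 1 − (1−Q)·h(1/2 + |⟨e₀, e₃⟩|/(2(1−Q))) − Q·h(1/2 + |⟨e₁, e₂⟩|/(2Q)). -/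

import Mathlib

open scoped BigOperators InnerProductSpace

/-- `η x = -x·log₂ x`, with `η 0 = 0`. -/
noncomputable def eta (x : ℝ) : ℝ := -x * Real.logb 2 x

/-- Von Neumann entropy (base 2) of a matrix: the sum of `η` applied to the
eigenvalues when the matrix is Hermitian, `0` otherwise. -/
noncomputable def vnEntropy {n : Type*} [Fintype n] [DecidableEq n]
    (M : Matrix n n ℂ) : ℝ :=
  if h : M.IsHermitian then ∑ i, eta (h.eigenvalues i) else 0

/-- Binary entropy (base 2). -/
noncomputable def binH (x : ℝ) : ℝ := -x * Real.logb 2 x - (1 - x) * Real.logb 2 (1 - x)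

/-- The outer product `|u⟩⟨u|` of a vector with itself. -/
noncomputable def outer {d : ℕ} (u : EuclideanSpace ℂ (Fin d)) :
    Matrix (Fin d) (Fin d) ℂ :=
  Matrix.vecMulVec (fun i => u i) (star fun i => u i)

open Matrix Filter Topology

/-- The overlap matrix of the eigenbases of two Hermitian matrices. -/
noncomputable def eigenOverlap {n : Type*} [Fintype n] [DecidableEq n] {A B : Matrix n n ℂ}
    (hA : A.IsHermitian) (hB : B.IsHermitian) : Matrix n n ℂ :=
  (hB.eigenvectorUnitary : Matrix n n ℂ)ᴴ * (hA.eigenvectorUnitary : Matrix n n ℂ)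

/-- `Re tr (A log B)`, computed in an eigenbasis of `B`. -/
noncomputable def traceMulLog {n : Type*} [Fintype n] [DecidableEq n] {B : Matrix n n ℂ}
    (A : Matrix n n ℂ) (hB : B.IsHermitian) : ℝ :=
  ∑ j, (((hB.eigenvectorUnitary : Matrix n n ℂ)ᴴ * A * hB.eigenvectorUnitary) j j).re *
    Real.log (hB.eigenvalues j)

/-- `⟨A, log (L_B + s R_A) 1⟩` for left multiplication `L_B` and right multiplication `R_A`. -/
noncomputable def modularLog {n : Type*} [Fintype n] [DecidableEq n] {A B : Matrix n n ℂ}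
    (hA : A.IsHermitian) (hB : B.IsHermitian) (s : ℝ) : ℝ :=
  ∑ j, ∑ i, ‖eigenOverlap hA hB j i‖ ^ 2 * (hA.eigenvalues i *
    Real.log (hB.eigenvalues j + s * hA.eigenvalues i))

/-- `⟨A, (L_B + s R_A)⁻¹ A⟩` for left multiplication `L_B` and right multiplication `R_A`. -/
noncomputable def modularResolvent {n : Type*} [Fintype n] [DecidableEq n] {A B : Matrix n n ℂ}
    (hA : A.IsHermitian) (hB : B.IsHermitian) (s : ℝ) : ℝ :=
  ∑ j, ∑ i, ‖eigenOverlap hA hB j i‖ ^ 2 * (hA.eigenvalues i *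
    (hA.eigenvalues i / (hB.eigenvalues j + s * hA.eigenvalues i)))

/-- The concave quadratic form in `Y`, linear in `(A, B)`, whose maximum is `modularResolvent`. -/
noncomputable def modularForm {n : Type*} [Fintype n] (A B : Matrix n n ℂ) (s : ℝ)
    (Y : Matrix n n ℂ) : ℝ :=
  2 * (Yᴴ * A).trace.re - (Yᴴ * B * Y).trace.re - s * (Y * A * Yᴴ).trace.re

lemma modularForm_add {n : Type*} [Fintype n] (A₁ A₂ B₁ B₂ : Matrix n n ℂ) (s : ℝ) (Y : Matrix n n ℂ) :
    modularForm (A₁ + A₂) (B₁ + B₂) s Y = modularForm A₁ B₁ s Y + modularForm A₂ B₂ s Y := by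
  simp only [modularForm, Matrix.mul_add, Matrix.add_mul, trace_add, Complex.add_re]
  ring

section ModularResolvent

open scoped ComplexOrder

variable {n : Type*} [Fintype n] [DecidableEq n] {A B : Matrix n n ℂ}

lemma eigenvectorUnitary_conjTranspose_mul_self (hA : A.IsHermitian) :
    (hA.eigenvectorUnitary : Matrix n n ℂ)ᴴ * (hA.eigenvectorUnitary : Matrix n n ℂ) = 1 := by
  rw [← star_eq_conjTranspose]; exact Unitary.coe_star_mul_self _

lemma eigenvectorUnitary_mul_conjTranspose_self (hA : A.IsHermitian) :
    (hA.eigenvectorUnitary : Matrix n n ℂ) * (hA.eigenvectorUnitary : Matrix n n ℂ)ᴴ = 1 := by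
  rw [← star_eq_conjTranspose]; exact Unitary.coe_mul_star_self _

lemma eq_eigenvectorUnitary_mul_diagonal_mul (hA : A.IsHermitian) :
    A = (hA.eigenvectorUnitary : Matrix n n ℂ) * diagonal (fun i => (hA.eigenvalues i : ℂ)) *
      (hA.eigenvectorUnitary : Matrix n n ℂ)ᴴ := by
  conv_lhs => rw [hA.spectral_theorem]
  rw [Unitary.conjStarAlgAut_apply]
  rfl

lemma eigenvectorUnitary_conj_self (hA : A.IsHermitian) :
    (hA.eigenvectorUnitary : Matrix n n ℂ)ᴴ * A * hA.eigenvectorUnitary =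
      diagonal (fun i => (hA.eigenvalues i : ℂ)) := by
  have h := eigenvectorUnitary_conjTranspose_mul_self hA
  have hd := eq_eigenvectorUnitary_mul_diagonal_mul hA
  set U := (hA.eigenvectorUnitary : Matrix n n ℂ)
  calc Uᴴ * A * U = Uᴴ * (U * diagonal (fun i => (hA.eigenvalues i : ℂ)) * Uᴴ) * U :=
        congrArg (fun M => Uᴴ * M * U) hd
    _ = Uᴴ * U * diagonal (fun i => (hA.eigenvalues i : ℂ)) * (Uᴴ * U) := by
        simp only [Matrix.mul_assoc]
    _ = _ := by rw [h, Matrix.one_mul, Matrix.mul_one]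

lemma eigenOverlap_conjTranspose_mul_self (hA : A.IsHermitian) (hB : B.IsHermitian) :
    (eigenOverlap hA hB)ᴴ * eigenOverlap hA hB = 1 := by
  rw [eigenOverlap, conjTranspose_mul, conjTranspose_conjTranspose, Matrix.mul_assoc,
    ← Matrix.mul_assoc (hB.eigenvectorUnitary : Matrix n n ℂ),
    eigenvectorUnitary_mul_conjTranspose_self, Matrix.one_mul,
    eigenvectorUnitary_conjTranspose_mul_self]

lemma sum_norm_sq_eigenOverlap (hA : A.IsHermitian) (hB : B.IsHermitian) (i : n) :
    ∑ j, ‖eigenOverlap hA hB j i‖ ^ 2 = 1 := by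
  have h := congrArg Complex.re
    (congrFun (congrFun (eigenOverlap_conjTranspose_mul_self hA hB) i) i)
  simpa [mul_apply, Complex.conj_mul', ← Complex.ofReal_pow] using h

/-- Matrix elements of `A` in the eigenbasis of `B`. -/
lemma conj_eigenvectorUnitary_apply_re (hA : A.IsHermitian) (hB : B.IsHermitian) (j : n) :
    (((hB.eigenvectorUnitary : Matrix n n ℂ)ᴴ * A * hB.eigenvectorUnitary) j j).re =
      ∑ i, ‖eigenOverlap hA hB j i‖ ^ 2 * hA.eigenvalues i := by
  have h : (hB.eigenvectorUnitary : Matrix n n ℂ)ᴴ * A * hB.eigenvectorUnitary =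
      eigenOverlap hA hB * diagonal (fun i => (hA.eigenvalues i : ℂ)) *
        (eigenOverlap hA hB)ᴴ := by
    conv_lhs => rw [eq_eigenvectorUnitary_mul_diagonal_mul hA]
    simp only [eigenOverlap, conjTranspose_mul, conjTranspose_conjTranspose, Matrix.mul_assoc]
  rw [h, mul_apply, Complex.re_sum]
  refine Finset.sum_congr rfl fun i _ => ?_
  rw [mul_diagonal, conjTranspose_apply, mul_right_comm, ← starRingEnd_apply, Complex.mul_conj',
    ← Complex.ofReal_pow, ← Complex.ofReal_mul, Complex.ofReal_re]

lemma modularForm_eq_sum (hA : A.IsHermitian) (hB : B.IsHermitian) (s : ℝ) (y : Matrix n n ℂ) :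
    modularForm A B s ((hB.eigenvectorUnitary : Matrix n n ℂ) * y *
        (hA.eigenvectorUnitary : Matrix n n ℂ)ᴴ) =
      ∑ j, ∑ i, (2 * hA.eigenvalues i * (star (y j i) * eigenOverlap hA hB j i).re -
        (hB.eigenvalues j + s * hA.eigenvalues i) * ‖y j i‖ ^ 2) := by
  have hU := eigenvectorUnitary_conjTranspose_mul_self hA
  have hV := eigenvectorUnitary_conjTranspose_mul_self hB
  have hAd := eq_eigenvectorUnitary_mul_diagonal_mul hA
  have hBd := eq_eigenvectorUnitary_mul_diagonal_mul hB
  have hw : eigenOverlap hA hB = (hB.eigenvectorUnitary : Matrix n n ℂ)ᴴ *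
    (hA.eigenvectorUnitary : Matrix n n ℂ) := rfl
  set U := (hA.eigenvectorUnitary : Matrix n n ℂ)
  set V := (hB.eigenvectorUnitary : Matrix n n ℂ)
  set a := diagonal (fun i => (hA.eigenvalues i : ℂ)) with ha
  set b := diagonal (fun i => (hB.eigenvalues i : ℂ)) with hb
  have hUl : ∀ M : Matrix n n ℂ, Uᴴ * (U * M) = M := fun M => by
    rw [← Matrix.mul_assoc, hU, Matrix.one_mul]
  have hVl : ∀ M : Matrix n n ℂ, Vᴴ * (V * M) = M := fun M => by
    rw [← Matrix.mul_assoc, hV, Matrix.one_mul]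
  have h₁ : ((V * y * Uᴴ)ᴴ * A).trace = ∑ j, ∑ i,
      star (y j i) * eigenOverlap hA hB j i * hA.eigenvalues i := by
    have : ((V * y * Uᴴ)ᴴ * A).trace = (yᴴ * (eigenOverlap hA hB * a)).trace := by
      rw [hw, hAd]
      simp only [conjTranspose_mul, conjTranspose_conjTranspose, Matrix.mul_assoc]
      rw [trace_mul_comm]
      simp only [Matrix.mul_assoc, hU, Matrix.mul_one]
    rw [this, Matrix.trace, Finset.sum_comm]
    refine Finset.sum_congr rfl fun i _ => ?_
    rw [diag_apply, mul_apply]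
    refine Finset.sum_congr rfl fun j _ => ?_
    rw [ha, mul_diagonal, conjTranspose_apply, mul_assoc]
  have h₂ : ((V * y * Uᴴ)ᴴ * B * (V * y * Uᴴ)).trace = ∑ j, ∑ i,
      ((hB.eigenvalues j * ‖y j i‖ ^ 2 : ℝ) : ℂ) := by
    have : ((V * y * Uᴴ)ᴴ * B * (V * y * Uᴴ)).trace = (yᴴ * (b * y)).trace := by
      rw [hBd]
      simp only [conjTranspose_mul, conjTranspose_conjTranspose, Matrix.mul_assoc, hVl]
      rw [trace_mul_comm]
      simp only [Matrix.mul_assoc, hU, Matrix.mul_one]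
    rw [this, Matrix.trace, Finset.sum_comm]
    refine Finset.sum_congr rfl fun i _ => ?_
    rw [diag_apply, mul_apply]
    refine Finset.sum_congr rfl fun j _ => ?_
    rw [hb, diagonal_mul, conjTranspose_apply, mul_left_comm, ← starRingEnd_apply,
      Complex.conj_mul', Complex.ofReal_mul, Complex.ofReal_pow]
  have h₃ : ((V * y * Uᴴ) * A * (V * y * Uᴴ)ᴴ).trace = ∑ j, ∑ i,
      ((hA.eigenvalues i * ‖y j i‖ ^ 2 : ℝ) : ℂ) := by
    have : ((V * y * Uᴴ) * A * (V * y * Uᴴ)ᴴ).trace = (y * (a * yᴴ)).trace := by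
      rw [hAd]
      simp only [conjTranspose_mul, conjTranspose_conjTranspose, Matrix.mul_assoc, hUl]
      rw [trace_mul_comm]
      simp only [Matrix.mul_assoc, hV, Matrix.mul_one]
    rw [this, Matrix.trace]
    refine Finset.sum_congr rfl fun i _ => ?_
    rw [diag_apply, mul_apply]
    refine Finset.sum_congr rfl fun j _ => ?_
    rw [ha, diagonal_mul, conjTranspose_apply, mul_left_comm, ← starRingEnd_apply,
      Complex.mul_conj', Complex.ofReal_mul, Complex.ofReal_pow]
  rw [modularForm, h₁, h₂, h₃]
  simp only [Complex.re_sum, Complex.ofReal_re, Complex.re_mul_ofReal, Finset.mul_sum,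
    ← Finset.sum_sub_distrib]
  refine Finset.sum_congr rfl fun j _ => Finset.sum_congr rfl fun i _ => ?_
  ring

lemma two_mul_re_sub_le {c a : ℝ} (hc : 0 < c) (y w : ℂ) :
    2 * a * (star y * w).re - c * ‖y‖ ^ 2 ≤ ‖w‖ ^ 2 * (a * (a / c)) := by
  have h : 0 ≤ (c * y.re - a * w.re) ^ 2 + (c * y.im - a * w.im) ^ 2 := by positivity
  have e : ‖w‖ ^ 2 * (a * (a / c)) - (2 * a * (star y * w).re - c * ‖y‖ ^ 2) =
      ((c * y.re - a * w.re) ^ 2 + (c * y.im - a * w.im) ^ 2) / c := by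
    rw [← Complex.normSq_eq_norm_sq, ← Complex.normSq_eq_norm_sq, Complex.normSq_apply,
      Complex.normSq_apply]
    simp only [RCLike.star_def, Complex.mul_re, Complex.conj_re, Complex.conj_im]
    field_simp
    ring
  linarith [div_nonneg h hc.le]

lemma modularForm_le_modularResolvent (hA : A.PosSemidef) (hB : B.PosSemidef) {s : ℝ}
    (hs : 0 < s) (Y : Matrix n n ℂ) :
    modularForm A B s Y ≤ modularResolvent hA.1 hB.1 s := by
  have hY : Y = (hB.1.eigenvectorUnitary : Matrix n n ℂ) *
      ((hB.1.eigenvectorUnitary : Matrix n n ℂ)ᴴ * Y * hA.1.eigenvectorUnitary) *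
        (hA.1.eigenvectorUnitary : Matrix n n ℂ)ᴴ := by
    simp only [Matrix.mul_assoc, eigenvectorUnitary_mul_conjTranspose_self, Matrix.mul_one]
    rw [← Matrix.mul_assoc, eigenvectorUnitary_mul_conjTranspose_self, Matrix.one_mul]
  rw [hY, modularForm_eq_sum, modularResolvent]
  refine Finset.sum_le_sum fun j _ => Finset.sum_le_sum fun i _ => ?_
  rcases (hA.eigenvalues_nonneg i).eq_or_lt with h | h
  · rw [← h]
    simp only [mul_zero, zero_mul, add_zero, zero_sub, neg_nonpos]
    exact mul_nonneg (hB.eigenvalues_nonneg j) (sq_nonneg _)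
  · exact two_mul_re_sub_le (add_pos_of_nonneg_of_pos (hB.eigenvalues_nonneg j) (mul_pos hs h)) _ _

lemma exists_modularForm_eq_modularResolvent (hA : A.PosSemidef) (hB : B.PosSemidef) {s : ℝ}
    (hs : 0 < s) : ∃ Y, modularForm A B s Y = modularResolvent hA.1 hB.1 s := by
  refine ⟨_, (modularForm_eq_sum hA.1 hB.1 s (Matrix.of fun j i =>
    ((hA.1.eigenvalues i / (hB.1.eigenvalues j + s * hA.1.eigenvalues i) : ℝ) : ℂ) *
      eigenOverlap hA.1 hB.1 j i)).trans ?_⟩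
  rw [modularResolvent]
  refine Finset.sum_congr rfl fun j _ => Finset.sum_congr rfl fun i _ => ?_
  rw [Matrix.of_apply]
  set w := eigenOverlap hA.1 hB.1 j i
  rcases (hA.eigenvalues_nonneg i).eq_or_lt with h | h
  · simp [← h]
  · have hc := add_pos_of_nonneg_of_pos (hB.eigenvalues_nonneg j) (mul_pos hs h)
    set c := hB.1.eigenvalues j + s * hA.1.eigenvalues i
    have e : (star (((hA.1.eigenvalues i / c : ℝ) : ℂ) * w) * w).re =
        hA.1.eigenvalues i / c * ‖w‖ ^ 2 := by
      rw [star_mul', mul_assoc, ← starRingEnd_apply, ← starRingEnd_apply, Complex.conj_ofReal,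
        Complex.conj_mul', ← Complex.ofReal_pow, ← Complex.ofReal_mul, Complex.ofReal_re]
    rw [e, norm_mul, Complex.norm_real, mul_pow, Real.norm_eq_abs, sq_abs]
    field_simp
    ring

/-- Joint subadditivity of `(A, B) ↦ ⟨A, (L_B + s R_A)⁻¹ A⟩`. -/
lemma modularResolvent_add_le {A₁ A₂ B₁ B₂ : Matrix n n ℂ} (hA₁ : A₁.PosSemidef)
    (hA₂ : A₂.PosSemidef) (hB₁ : B₁.PosSemidef) (hB₂ : B₂.PosSemidef) {s : ℝ} (hs : 0 < s) :
    modularResolvent (hA₁.add hA₂).1 (hB₁.add hB₂).1 s ≤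
      modularResolvent hA₁.1 hB₁.1 s + modularResolvent hA₂.1 hB₂.1 s := by
  obtain ⟨Y, hY⟩ := exists_modularForm_eq_modularResolvent (hA₁.add hA₂) (hB₁.add hB₂) hs
  rw [← hY, modularForm_add]
  exact add_le_add (modularForm_le_modularResolvent hA₁ hB₁ hs Y)
    (modularForm_le_modularResolvent hA₂ hB₂ hs Y)

lemma hasDerivAt_modularLog (hA : A.PosSemidef) (hB : B.PosSemidef) {s : ℝ} (hs : 0 < s) :
    HasDerivAt (modularLog hA.1 hB.1) (modularResolvent hA.1 hB.1 s) s := by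
  unfold modularLog modularResolvent
  refine HasDerivAt.fun_sum fun j _ => HasDerivAt.fun_sum fun i _ => ?_
  refine HasDerivAt.const_mul _ ?_
  rcases (hA.eigenvalues_nonneg i).eq_or_lt with h | h
  · simpa [← h] using hasDerivAt_const s (0 : ℝ)
  · refine HasDerivAt.const_mul _ (HasDerivAt.log ?_ ?_)
    · simpa using ((hasDerivAt_id s).mul_const (hA.1.eigenvalues i)).const_add
        (hB.1.eigenvalues j)
    · exact (add_pos_of_nonneg_of_pos (hB.eigenvalues_nonneg j) (mul_pos hs h)).ne'

lemma tendsto_modularLog_zero (hA : A.PosSemidef) (hB : B.PosSemidef)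
    (hAB : (B - A).PosSemidef) :
    Tendsto (modularLog hA.1 hB.1) (𝓝[>] 0) (𝓝 (traceMulLog A hB.1)) := by
  have hT : traceMulLog A hB.1 = ∑ j, ∑ i, ‖eigenOverlap hA.1 hB.1 j i‖ ^ 2 *
      (hA.1.eigenvalues i * Real.log (hB.1.eigenvalues j)) := by
    rw [traceMulLog]
    refine Finset.sum_congr rfl fun j _ => ?_
    rw [conj_eigenvectorUnitary_apply_re hA.1, Finset.sum_mul]
    exact Finset.sum_congr rfl fun i _ => mul_assoc _ _ _
  rw [hT]
  refine tendsto_finsetSum _ fun j _ => tendsto_finsetSum _ fun i _ => ?_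
  rcases (hB.eigenvalues_nonneg j).eq_or_lt with h | h
  · have hle : ∑ i, ‖eigenOverlap hA.1 hB.1 j i‖ ^ 2 * hA.1.eigenvalues i ≤ 0 := by
      have h₀ := Complex.le_def.1 ((hAB.conjTranspose_mul_mul_same
        (hB.1.eigenvectorUnitary : Matrix n n ℂ)).diag_nonneg (i := j))
      have h₁ := h₀.1
      rw [Matrix.mul_sub, Matrix.sub_mul, Matrix.sub_apply, Complex.sub_re,
        conj_eigenvectorUnitary_apply_re hA.1, eigenvectorUnitary_conj_self, diagonal_apply_eq,
        ← h] at h₁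
      simpa using h₁
    have hnn : ∀ i ∈ Finset.univ,
        0 ≤ ‖eigenOverlap hA.1 hB.1 j i‖ ^ 2 * hA.1.eigenvalues i := fun i _ =>
      mul_nonneg (sq_nonneg _) (hA.eigenvalues_nonneg i)
    have h0 := (Finset.sum_eq_zero_iff_of_nonneg hnn).1
      (le_antisymm hle (Finset.sum_nonneg hnn)) i (Finset.mem_univ i)
    simp only [← mul_assoc, h0, zero_mul]
    exact tendsto_const_nhds
  · refine ((Tendsto.log ?_ h.ne').const_mul _).const_mul _
    refine tendsto_nhdsWithin_of_tendsto_nhds ?_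
    have : Continuous fun s : ℝ => hB.1.eigenvalues j + s * hA.1.eigenvalues i := by fun_prop
    simpa using this.tendsto 0

lemma tendsto_modularLog_atTop (hA : A.PosSemidef) (hB : B.PosSemidef) :
    Tendsto (fun s => modularLog hA.1 hB.1 s - A.trace.re * Real.log s) atTop
      (𝓝 (∑ i, hA.1.eigenvalues i * Real.log (hA.1.eigenvalues i))) := by
  have hsum : ∀ f : n → ℝ, ∑ i, f i = ∑ j, ∑ i, ‖eigenOverlap hA.1 hB.1 j i‖ ^ 2 * f i := by
    intro f
    rw [Finset.sum_comm]
    simp only [← Finset.sum_mul, sum_norm_sq_eigenOverlap, one_mul]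
  have htr : A.trace.re = ∑ i, hA.1.eigenvalues i := by
    rw [hA.1.trace_eq_sum_eigenvalues, Complex.re_sum]
    rfl
  rw [hsum, htr]
  simp only [Finset.sum_mul]
  simp only [hsum (fun i => hA.1.eigenvalues i * _), modularLog, ← Finset.sum_sub_distrib,
    ← mul_sub]
  refine tendsto_finsetSum _ fun j _ => tendsto_finsetSum _ fun i _ => ?_
  refine Tendsto.const_mul _ ?_
  rcases (hA.eigenvalues_nonneg i).eq_or_lt with h | h
  · simp [← h]
  · refine Tendsto.const_mul _ ?_
    have hlim : Tendsto (fun s : ℝ => Real.log (hB.1.eigenvalues j / s + hA.1.eigenvalues i)) atTop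
        (𝓝 (Real.log (hA.1.eigenvalues i))) := by
      refine Tendsto.log ?_ h.ne'
      simpa using (tendsto_const_nhds.div_atTop tendsto_id).add_const (hA.1.eigenvalues i)
    refine hlim.congr' ?_
    filter_upwards [eventually_gt_atTop 0] with s hs
    have hc := add_pos_of_nonneg_of_pos (hB.eigenvalues_nonneg j) (mul_pos hs h)
    rw [← Real.log_div hc.ne' hs.ne']
    congr 1
    field_simp

/-- Joint subadditivity of the relative entropy `tr (A log A) - tr (A log B)`. -/
lemma relEntropy_add_le {A₁ A₂ B₁ B₂ : Matrix n n ℂ} (hA₁ : A₁.PosSemidef)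
    (hA₂ : A₂.PosSemidef) (hB₁ : B₁.PosSemidef) (hB₂ : B₂.PosSemidef)
    (h₁ : (B₁ - A₁).PosSemidef) (h₂ : (B₂ - A₂).PosSemidef) :
    ∑ i, (hA₁.add hA₂).1.eigenvalues i * Real.log ((hA₁.add hA₂).1.eigenvalues i) -
        traceMulLog (A₁ + A₂) (hB₁.add hB₂).1 ≤
      (∑ i, hA₁.1.eigenvalues i * Real.log (hA₁.1.eigenvalues i) - traceMulLog A₁ hB₁.1) +
      (∑ i, hA₂.1.eigenvalues i * Real.log (hA₂.1.eigenvalues i) - traceMulLog A₂ hB₂.1) := by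
  have h₁₂ : (B₁ + B₂ - (A₁ + A₂)).PosSemidef := by
    rw [add_sub_add_comm]; exact h₁.add h₂
  set Φ : ℝ → ℝ := fun s => modularLog hA₁.1 hB₁.1 s + modularLog hA₂.1 hB₂.1 s -
    modularLog (hA₁.add hA₂).1 (hB₁.add hB₂).1 s with hΦ
  have hder : ∀ s, 0 < s → HasDerivAt Φ (modularResolvent hA₁.1 hB₁.1 s +
      modularResolvent hA₂.1 hB₂.1 s - modularResolvent (hA₁.add hA₂).1 (hB₁.add hB₂).1 s) s :=
    fun s hs => ((hasDerivAt_modularLog hA₁ hB₁ hs).add (hasDerivAt_modularLog hA₂ hB₂ hs)).sub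
      (hasDerivAt_modularLog (hA₁.add hA₂) (hB₁.add hB₂) hs)
  have hmono : MonotoneOn Φ (Set.Ioi 0) := by
    refine monotoneOn_of_deriv_nonneg (convex_Ioi 0)
      (fun s hs => (hder s hs).continuousAt.continuousWithinAt) ?_ ?_
    · rw [interior_Ioi]
      exact fun s hs => (hder s hs).differentiableAt.differentiableWithinAt
    · rw [interior_Ioi]
      intro s hs
      rw [(hder s hs).deriv]
      exact sub_nonneg.2 (modularResolvent_add_le hA₁ hA₂ hB₁ hB₂ hs)
  have h0 : Tendsto Φ (𝓝[>] 0) (𝓝 _) := ((tendsto_modularLog_zero hA₁ hB₁ h₁).add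
    (tendsto_modularLog_zero hA₂ hB₂ h₂)).sub
      (tendsto_modularLog_zero (hA₁.add hA₂) (hB₁.add hB₂) h₁₂)
  have htop : Tendsto Φ atTop (𝓝 _) := (((tendsto_modularLog_atTop hA₁ hB₁).add
    (tendsto_modularLog_atTop hA₂ hB₂)).sub
      (tendsto_modularLog_atTop (hA₁.add hA₂) (hB₁.add hB₂))).congr fun s => by
    rw [hΦ, trace_add, Complex.add_re]
    ring
  have hle : ∀ s, 0 < s → _ ≤ Φ s := fun s hs => le_of_tendsto h0 (by
    filter_upwards [Ioc_mem_nhdsGT hs] with t ht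
    exact hmono ht.1 hs ht.2)
  have := ge_of_tendsto htop ((eventually_gt_atTop 0).mono hle)
  linarith

end ModularResolvent

section Entropy

open scoped ComplexOrder

variable {n : Type*} [Fintype n] [DecidableEq n]

lemma traceMulLog_add {B : Matrix n n ℂ} (A C : Matrix n n ℂ) (hB : B.IsHermitian) :
    traceMulLog (A + C) hB = traceMulLog A hB + traceMulLog C hB := by
  simp only [traceMulLog, Matrix.mul_add, Matrix.add_apply, Complex.add_re,
    add_mul, Finset.sum_add_distrib]

lemma traceMulLog_self {B : Matrix n n ℂ} (hB : B.IsHermitian) :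
    traceMulLog B hB = ∑ i, hB.eigenvalues i * Real.log (hB.eigenvalues i) := by
  simp only [traceMulLog, eigenvectorUnitary_conj_self, diagonal_apply_eq, Complex.ofReal_re]

lemma vnEntropy_mul_log_two {M : Matrix n n ℂ} (hM : M.IsHermitian) :
    vnEntropy M * Real.log 2 = -∑ i, hM.eigenvalues i * Real.log (hM.eigenvalues i) := by
  have h2 : Real.log 2 ≠ 0 := (Real.log_pos one_lt_two).ne'
  rw [vnEntropy, dif_pos hM, Finset.sum_mul, ← Finset.sum_neg_distrib]
  refine Finset.sum_congr rfl fun i _ => ?_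
  rw [eta, Real.logb]
  field_simp

/-- Strong subadditivity for states that are classical on two binary systems. -/
lemma vnEntropy_strong_subadditivity {A₁ A₂ C₁ C₂ : Matrix n n ℂ} (hA₁ : A₁.PosSemidef)
    (hA₂ : A₂.PosSemidef) (hC₁ : C₁.PosSemidef) (hC₂ : C₂.PosSemidef) :
    vnEntropy A₁ + vnEntropy A₂ + vnEntropy C₁ + vnEntropy C₂ -
        vnEntropy (A₁ + C₁) - vnEntropy (A₂ + C₂) ≤
      vnEntropy (A₁ + A₂) + vnEntropy (C₁ + C₂) - vnEntropy (A₁ + C₁ + (A₂ + C₂)) := by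
  have hB₁ := hA₁.add hC₁
  have hB₂ := hA₂.add hC₂
  have hA := relEntropy_add_le hA₁ hA₂ hB₁ hB₂ (by rwa [add_sub_cancel_left])
    (by rwa [add_sub_cancel_left])
  have hC := relEntropy_add_le hC₁ hC₂ hB₁ hB₂ (by rwa [add_sub_cancel_right])
    (by rwa [add_sub_cancel_right])
  have t₁ := (traceMulLog_add A₁ C₁ hB₁.1).symm.trans (traceMulLog_self hB₁.1)
  have t₂ := (traceMulLog_add A₂ C₂ hB₂.1).symm.trans (traceMulLog_self hB₂.1)
  have t := (traceMulLog_add (A₁ + A₂) (C₁ + C₂) (hB₁.add hB₂).1).symm.trans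
    ((congrArg (traceMulLog · (hB₁.add hB₂).1) (add_add_add_comm A₁ A₂ C₁ C₂)).trans
      (traceMulLog_self (hB₁.add hB₂).1))
  refine le_of_mul_le_mul_right ?_ (Real.log_pos one_lt_two)
  simp only [add_mul, sub_mul, vnEntropy_mul_log_two hA₁.1, vnEntropy_mul_log_two hA₂.1,
    vnEntropy_mul_log_two hC₁.1, vnEntropy_mul_log_two hC₂.1, vnEntropy_mul_log_two hB₁.1,
    vnEntropy_mul_log_two hB₂.1, vnEntropy_mul_log_two (hA₁.add hA₂).1,
    vnEntropy_mul_log_two (hC₁.add hC₂).1, vnEntropy_mul_log_two (hB₁.add hB₂).1]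
  linarith

lemma vnEntropy_eq_sum_roots {M : Matrix n n ℂ} (hM : M.IsHermitian) :
    vnEntropy M = (M.charpoly.roots.map fun z => eta z.re).sum := by
  rw [vnEntropy, dif_pos hM, hM.roots_charpoly_eq_eigenvalues, Multiset.map_map]
  rfl

lemma charpoly_blockDiagonal {R : Type*} [CommRing R] {o : Type*} [Fintype o] [DecidableEq o]
    (M : o → Matrix n n R) : (blockDiagonal M).charpoly = ∏ k, (M k).charpoly := by
  simp only [charpoly]
  rw [← det_blockDiagonal]
  congr 1
  ext ⟨i, k⟩ ⟨j, l⟩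
  by_cases hkl : k = l
  · subst hkl
    by_cases hij : i = j
    · subst hij
      simp [blockDiagonal_apply]
    · simp [blockDiagonal_apply, hij, charmatrix_apply_ne]
  · rw [blockDiagonal_apply_ne _ _ _ hkl, charmatrix_apply_ne _ _ _ (by simp [hkl]),
      blockDiagonal_apply_ne _ _ _ hkl]
    simp

lemma vnEntropy_blockDiagonal {o : Type*} [Fintype o] [DecidableEq o] {M : o → Matrix n n ℂ}
    (hM : ∀ k, (M k).IsHermitian) :
    vnEntropy (blockDiagonal M) = ∑ k, vnEntropy (M k) := by
  have h : (blockDiagonal M).IsHermitian := by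
    rw [IsHermitian, blockDiagonal_conjTranspose]
    exact congrArg _ (funext hM)
  rw [vnEntropy_eq_sum_roots h, charpoly_blockDiagonal, Polynomial.roots_prod _ _
    (Finset.prod_ne_zero_iff.2 fun k _ => (charpoly_monic _).ne_zero), Multiset.map_bind,
    Multiset.sum_bind]
  simp only [fun k => vnEntropy_eq_sum_roots (hM k)]
  rfl

lemma eta_zero : eta 0 = 0 := by simp [eta]

lemma vnEntropy_mul_conjTranspose_comm {m : Type*} [Fintype m] [DecidableEq m]
    (E : Matrix n m ℂ) : vnEntropy (E * Eᴴ) = vnEntropy (Eᴴ * E) := by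
  have h := congrArg (fun p => (p.roots.map fun z => eta z.re).sum) (charpoly_mul_comm' E Eᴴ)
  have hX : ∀ k : ℕ, (Polynomial.X ^ k : Polynomial ℂ) ≠ 0 := fun k =>
    pow_ne_zero _ Polynomial.X_ne_zero
  simp only [Polynomial.roots_mul (mul_ne_zero (hX _) (charpoly_monic _).ne_zero),
    Multiset.map_add, Multiset.sum_add, Polynomial.roots_X_pow, Multiset.map_nsmul,
    Multiset.sum_nsmul, Multiset.map_singleton, Multiset.sum_singleton, Complex.zero_re, eta_zero,
    smul_zero, zero_add] at h
  rw [vnEntropy_eq_sum_roots (isHermitian_mul_conjTranspose_self E),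
    vnEntropy_eq_sum_roots (isHermitian_conjTranspose_mul_self E), h]

lemma eta_mul (x y : ℝ) : eta (x * y) = x * eta y + y * eta x := by
  rcases eq_or_ne x 0 with rfl | hx
  · simp [eta]
  rcases eq_or_ne y 0 with rfl | hy
  · simp [eta]
  rw [eta, eta, eta, Real.logb_mul hx hy]
  ring

lemma eta_half : eta (1 / 2) = 1 / 2 := by
  rw [eta, one_div, Real.logb_inv, Real.logb_self_eq_one one_lt_two]
  norm_num

end Entropy

section Outer

open scoped ComplexOrder

variable {d : ℕ}

lemma outer_posSemidef (u : EuclideanSpace ℂ (Fin d)) : (outer u).PosSemidef :=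
  posSemidef_vecMulVec_self_star _

lemma half_smul_outer_posSemidef (u : EuclideanSpace ℂ (Fin d)) :
    ((1 / 2 : ℝ) • outer u).PosSemidef :=
  (outer_posSemidef u).smul (by norm_num)

lemma half_smul_outer_add_outer_posSemidef (u v : EuclideanSpace ℂ (Fin d)) :
    ((1 / 2 : ℝ) • (outer u + outer v)).PosSemidef :=
  ((outer_posSemidef u).add (outer_posSemidef v)).smul (by norm_num)

lemma vnEntropy_half_smul_sum_outer {m : Type*} [Fintype m] [DecidableEq m]
    (w : m → EuclideanSpace ℂ (Fin d)) :
    vnEntropy ((1 / 2 : ℝ) • ∑ k, outer (w k)) = vnEntropy ((1 / 2 : ℝ) • gram ℂ w) := by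
  have hr : ((√(1 / 2) : ℝ) : ℂ) * ((√(1 / 2) : ℝ) : ℂ) = 1 / 2 := by
    rw [← Complex.ofReal_mul, Real.mul_self_sqrt (by norm_num)]
    norm_num
  let E : Matrix (Fin d) m ℂ := Matrix.of fun i k => ((√(1 / 2) : ℝ) : ℂ) * w k i
  have h₁ : (1 / 2 : ℝ) • ∑ k, outer (w k) = E * Eᴴ := by
    ext i j
    rw [Matrix.smul_apply, Matrix.sum_apply, mul_apply, Finset.smul_sum]
    refine Finset.sum_congr rfl fun k _ => ?_
    simp only [E, outer, vecMulVec_apply, Pi.star_apply, conjTranspose_apply, Matrix.of_apply,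
      star_mul', RCLike.star_def, Complex.conj_ofReal, Complex.real_smul]
    rw [mul_mul_mul_comm, hr]
    norm_num
  have h₂ : (1 / 2 : ℝ) • gram ℂ w = Eᴴ * E := by
    ext k l
    rw [Matrix.smul_apply, gram_apply, mul_apply, PiLp.inner_apply, Finset.smul_sum]
    refine Finset.sum_congr rfl fun i _ => ?_
    simp only [E, conjTranspose_apply, Matrix.of_apply, star_mul', RCLike.star_def,
      Complex.conj_ofReal, Complex.real_smul, RCLike.inner_apply]
    rw [mul_mul_mul_comm, hr, mul_comm (w l i)]
    norm_num
  rw [h₁, h₂, vnEntropy_mul_conjTranspose_comm]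

lemma half_smul_gram_isHermitian {m : Type*} (w : m → EuclideanSpace ℂ (Fin d)) :
    ((1 / 2 : ℝ) • gram ℂ w).IsHermitian := by
  ext i j
  simp [gram_apply]

lemma vnEntropy_half_smul_outer (u : EuclideanSpace ℂ (Fin d)) :
    vnEntropy ((1 / 2 : ℝ) • outer u) = eta (1 / 2 * ‖u‖ ^ 2) := by
  have h := vnEntropy_half_smul_sum_outer fun _ : Unit => u
  have hc : ((1 / 2 : ℝ) • gram ℂ fun _ : Unit => u).charpoly =
      Polynomial.X - Polynomial.C ((1 / 2 * ‖u‖ ^ 2 : ℝ) : ℂ) := by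
    simp [charpoly, gram_apply, inner_self_eq_norm_sq_to_K]
  rw [vnEntropy_eq_sum_roots (half_smul_gram_isHermitian _), hc, Polynomial.roots_X_sub_C,
    Multiset.map_singleton, Multiset.sum_singleton, Complex.ofReal_re] at h
  simpa using h

/-- Entropy of the equal mixture of two vectors of the same norm. -/
lemma vnEntropy_half_smul_outer_add_outer {u v : EuclideanSpace ℂ (Fin d)} {q : ℝ} (hq : 0 < q)
    (hu : ‖u‖ ^ 2 = q) (hv : ‖v‖ ^ 2 = q) :
    vnEntropy ((1 / 2 : ℝ) • (outer u + outer v)) =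
      eta q + q * binH (1 / 2 + ‖⟪u, v⟫_ℂ‖ / (2 * q)) := by
  have h := vnEntropy_half_smul_sum_outer ![u, v]
  set p : ℝ := 1 / 2 + ‖⟪u, v⟫_ℂ‖ / (2 * q) with hp
  have hg : ‖⟪u, v⟫_ℂ‖ = q * (2 * p - 1) := by
    rw [hp]
    field_simp
    ring
  have hu' : ⟪u, u⟫_ℂ = (q : ℂ) := by
    rw [inner_self_eq_norm_sq_to_K, ← hu]
    simp
  have hv' : ⟪v, v⟫_ℂ = (q : ℂ) := by
    rw [inner_self_eq_norm_sq_to_K, ← hv]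
    simp
  have hvu : ⟪u, v⟫_ℂ * ⟪v, u⟫_ℂ = ((q * (2 * p - 1) : ℝ) : ℂ) ^ 2 := by
    rw [← inner_conj_symm v u, Complex.mul_conj', hg]
  have hc : ((1 / 2 : ℝ) • gram ℂ ![u, v]).charpoly =
      (Polynomial.X - Polynomial.C ((q * p : ℝ) : ℂ)) *
        (Polynomial.X - Polynomial.C ((q * (1 - p) : ℝ) : ℂ)) := by
    have htr : ((1 / 2 : ℝ) • gram ℂ ![u, v]).trace =
        ((q * p : ℝ) : ℂ) + ((q * (1 - p) : ℝ) : ℂ) := by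
      rw [trace_fin_two]
      simp only [Matrix.smul_apply, gram_apply, cons_val_zero, cons_val_one, hu', hv',
        Complex.real_smul]
      push_cast
      ring
    have hdet : ((1 / 2 : ℝ) • gram ℂ ![u, v]).det =
        ((q * p : ℝ) : ℂ) * ((q * (1 - p) : ℝ) : ℂ) := by
      rw [det_fin_two]
      simp only [Matrix.smul_apply, gram_apply, cons_val_zero, cons_val_one, hu', hv',
        Complex.real_smul]
      rw [mul_mul_mul_comm _ ⟪u, v⟫_ℂ, hvu]
      push_cast
      ring
    rw [charpoly_fin_two, htr, hdet, Polynomial.C_add, Polynomial.C_mul]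
    ring
  rw [vnEntropy_eq_sum_roots (half_smul_gram_isHermitian _), hc, Polynomial.roots_mul
    (mul_ne_zero (Polynomial.X_sub_C_ne_zero _) (Polynomial.X_sub_C_ne_zero _)),
    Polynomial.roots_X_sub_C, Polynomial.roots_X_sub_C, Multiset.map_add, Multiset.sum_add,
    Multiset.map_singleton, Multiset.map_singleton, Multiset.sum_singleton,
    Multiset.sum_singleton, Complex.ofReal_re, Complex.ofReal_re, eta_mul, eta_mul,
    Fin.sum_univ_two] at h
  have hb : binH p = eta p + eta (1 - p) := by
    rw [binH, eta, eta]
    ring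
  rw [hb]
  simp only [cons_val_zero, cons_val_one] at h
  linarith

end Outer

theorem stmt4 (d : ℕ) (Q : ℝ) (hQ : Q ∈ Set.Ioo (0 : ℝ) 1)
    (e₀ e₁ e₂ e₃ : EuclideanSpace ℂ (Fin d))
    (he₀ : ‖e₀‖ ^ 2 = 1 - Q) (he₃ : ‖e₃‖ ^ 2 = 1 - Q)
    (he₁ : ‖e₁‖ ^ 2 = Q) (he₂ : ‖e₂‖ ^ 2 = Q)
    (χAE : Matrix (Fin d × Fin 2) (Fin d × Fin 2) ℂ)
    (hχAE : χAE = Matrix.blockDiagonal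
      ![((1 / 2 : ℝ)) • (outer e₀ + outer e₁),
        ((1 / 2 : ℝ)) • (outer e₂ + outer e₃)])
    (χE : Matrix (Fin d) (Fin d) ℂ)
    (hχE : χE = ((1 / 2 : ℝ)) • (outer e₀ + outer e₁ + outer e₂ + outer e₃)) :
    vnEntropy χAE - vnEntropy χE ≥
      1 - (1 - Q) * binH (1 / 2 + ‖⟪e₀, e₃⟫_ℂ‖ / (2 * (1 - Q)))
        - Q * binH (1 / 2 + ‖⟪e₁, e₂⟫_ℂ‖ / (2 * Q)) := by
  have hAE : vnEntropy χAE = vnEntropy ((1 / 2 : ℝ) • (outer e₀ + outer e₁)) +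
      vnEntropy ((1 / 2 : ℝ) • (outer e₂ + outer e₃)) := by
    rw [hχAE, vnEntropy_blockDiagonal, Fin.sum_univ_two]
    · rfl
    · intro k
      fin_cases k
      · exact (half_smul_outer_add_outer_posSemidef e₀ e₁).1
      · exact (half_smul_outer_add_outer_posSemidef e₂ e₃).1
  have hssa := vnEntropy_strong_subadditivity (half_smul_outer_posSemidef e₀)
    (half_smul_outer_posSemidef e₁) (half_smul_outer_posSemidef e₃) (half_smul_outer_posSemidef e₂)
  simp only [← smul_add] at hssa
  have hE : outer e₀ + outer e₃ + (outer e₁ + outer e₂) =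
      outer e₀ + outer e₁ + outer e₂ + outer e₃ := by abel
  rw [hE, ← hχE, add_comm (outer e₃) (outer e₂),
    vnEntropy_half_smul_outer_add_outer (sub_pos.2 hQ.2) he₀ he₃,
    vnEntropy_half_smul_outer_add_outer hQ.1 he₁ he₂, vnEntropy_half_smul_outer,
    vnEntropy_half_smul_outer, vnEntropy_half_smul_outer, vnEntropy_half_smul_outer,
    he₀, he₁, he₂, he₃, eta_mul, eta_mul, eta_half] at hssa
  rw [hAE]
  linarith
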